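/- arXiv:1809.06774 — 2 statements merged into one kernel-verified Lean document; each statement's English description precedes it below -/
import Mathlib

section
/- For any coded prae-dilator T, the construction D^T is a prae-dilator on all linear orders: for every order embedding f : X → Y the map D^T_f(⟨a,σ⟩) := ⟨f[a],σ⟩ is a strictly increasing map from D^T_X to D^T_Y; D^T preserves identities and composition; the family supp^{D^T}_X(⟨a,σ⟩) := a is a natural transformation (supp^{D^T}_Y(D^T_f(x)) = f[supp^{D^T}_X(x)]); and every ⟨a,σ⟩ ∈ D^T_X lies in the range of D^T applied to the inclusion a ↪ X. -/
structure PraeDilator where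
  A : ℕ → Type
  inst : ∀ n, LinearOrder (A n)
  map : ∀ {n m : ℕ}, (Fin n ↪o Fin m) → A n → A m
  map_strictMono : ∀ {n m : ℕ} (f : Fin n ↪o Fin m) (σ τ : A n),
      (inst n).lt σ τ → (inst m).lt (map f σ) (map f τ)
  map_id : ∀ (n : ℕ) (σ : A n), map (OrderIso.refl (Fin n)).toOrderEmbedding σ = σ
  map_comp : ∀ {n m k : ℕ} (f : Fin n ↪o Fin m) (g : Fin m ↪o Fin k) (σ : A n),
      map (f.trans g) σ = map g (map f σ)
  supp : ∀ n, A n → Finset (Fin n)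
  supp_natural : ∀ {n m : ℕ} (f : Fin n ↪o Fin m) (σ : A n),
      supp m (map f σ) = (supp n σ).map f.toEmbedding
  supp_spec : ∀ (n : ℕ) (σ : A n),
      ∃ τ : A (supp n σ).card, map ((supp n σ).orderEmbOfFin rfl) τ = σ

attribute [instance] PraeDilator.inst



/-- The strictly increasing map `Fin a.card ↪o Fin d.card` induced by an inclusion `a ⊆ d`. -/
def inclEmb {X : Type} [LinearOrder X] {a d : Finset X} (h : a ⊆ d) :
    Fin a.card ↪o Fin d.card :=
  OrderEmbedding.ofStrictMono
    (fun i => (d.orderIsoOfFin rfl).symm ⟨a.orderEmbOfFin rfl i, h (a.orderEmbOfFin_mem rfl i)⟩)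
    (fun i j hij => by
      apply (d.orderIsoOfFin rfl).symm.strictMono
      exact Subtype.mk_lt_mk.mpr ((a.orderEmbOfFin rfl).strictMono hij))

structure DApp (D : PraeDilator) (X : Type) [LinearOrder X] where
  a : Finset X
  σ : D.A a.card
  hsupp : D.supp a.card σ = Finset.univ

def DLt (D : PraeDilator) (X : Type) [LinearOrder X] (x y : DApp D X) : Prop :=
  D.map (inclEmb (Finset.subset_union_left : x.a ⊆ x.a ∪ y.a)) x.σ <
    D.map (inclEmb (Finset.subset_union_right : y.a ⊆ x.a ∪ y.a)) y.σ

/-- Transport along an equality of indices. -/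
def castA (D : PraeDilator) {n m : ℕ} (h : n = m) (σ : D.A n) : D.A m := h ▸ σ

theorem supp_castA (D : PraeDilator) {n m : ℕ} (h : n = m) (σ : D.A n) :
    D.supp m (castA D h σ) = Finset.univ ↔ D.supp n σ = Finset.univ := by
  subst h; rfl

/-- The action of `D^T` on an order embedding `f : X ↪o Y`. -/
def DMap (D : PraeDilator) {X Y : Type} [LinearOrder X] [LinearOrder Y] (f : X ↪o Y)
    (x : DApp D X) : DApp D Y where
  a := x.a.map f.toEmbedding
  σ := castA D (Finset.card_map f.toEmbedding).symm x.σ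
  hsupp := (supp_castA D _ _).mpr x.hsupp

theorem castA_castA (D : PraeDilator) {n m k : ℕ} (h : n = m) (h' : m = k) (σ : D.A n) :
    castA D h' (castA D h σ) = castA D (h.trans h') σ := by
  subst h; subst h'; rfl

theorem castA_eq_map (D : PraeDilator) {n m : ℕ} (h : n = m) (σ : D.A n) :
    castA D h σ = D.map (Fin.castOrderIso h).toOrderEmbedding σ := by
  subst h
  exact (D.map_id n σ).symm

theorem DApp.ext_castA {D : PraeDilator} {X : Type} [LinearOrder X] {x y : DApp D X}
    (ha : x.a = y.a) (hσ : castA D (congrArg Finset.card ha) x.σ = y.σ) : x = y := by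
  obtain ⟨a, σ, h⟩ := x
  obtain ⟨b, τ, h'⟩ := y
  obtain rfl : a = b := ha
  obtain rfl : σ = τ := hσ
  rfl

theorem orderEmbOfFin_inclEmb {X : Type} [LinearOrder X] {a d : Finset X} (h : a ⊆ d)
    (i : Fin a.card) : d.orderEmbOfFin rfl (inclEmb h i) = a.orderEmbOfFin rfl i := by
  rw [← Finset.coe_orderIsoOfFin_apply]
  exact congrArg Subtype.val ((d.orderIsoOfFin rfl).apply_symm_apply _)

theorem orderEmbOfFin_map {X Y : Type} [LinearOrder X] [LinearOrder Y] (f : X ↪o Y)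
    {a : Finset X} {b : Finset Y} (hb : b = a.map f.toEmbedding) (hc : a.card = b.card)
    (i : Fin a.card) :
    b.orderEmbOfFin rfl (Fin.cast hc i) = f (a.orderEmbOfFin rfl i) := by
  have key := Finset.orderEmbOfFin_unique (s := b) hc.symm
    (f := fun i => f (a.orderEmbOfFin rfl i))
    (fun i => by
      rw [hb]
      exact Finset.mem_map_of_mem f.toEmbedding (a.orderEmbOfFin_mem rfl i))
    (f.strictMono.comp (a.orderEmbOfFin rfl).strictMono)
  rw [congrFun key i]
  exact Finset.orderEmbOfFin_eq_orderEmbOfFin_iff.mpr rfl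

/-- Restricting along inclusions commutes with the action of an order embedding. -/
theorem map_inclEmb_castA (D : PraeDilator) {X Y : Type} [LinearOrder X] [LinearOrder Y]
    (f : X ↪o Y) {a d : Finset X} {b e : Finset Y} (hb : b = a.map f.toEmbedding)
    (he : e = d.map f.toEmbedding) (h : a ⊆ d) (h' : b ⊆ e) (hab : a.card = b.card)
    (hde : d.card = e.card) (σ : D.A a.card) :
    D.map (inclEmb h') (castA D hab σ) = castA D hde (D.map (inclEmb h) σ) := by
  rw [castA_eq_map, castA_eq_map, ← D.map_comp, ← D.map_comp]
  congr 1
  ext1 i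
  apply (e.orderEmbOfFin rfl).injective
  change e.orderEmbOfFin rfl (inclEmb h' (Fin.cast hab i)) =
    e.orderEmbOfFin rfl (Fin.cast hde (inclEmb h i))
  rw [orderEmbOfFin_inclEmb, orderEmbOfFin_map f hb, orderEmbOfFin_map f he,
    orderEmbOfFin_inclEmb]

theorem castA_lt_castA (D : PraeDilator) {n m : ℕ} (h : n = m) {σ τ : D.A n} (hlt : σ < τ) :
    castA D h σ < castA D h τ := by
  subst h; exact hlt

theorem DLt.map {D : PraeDilator} {X Y : Type} [LinearOrder X] [LinearOrder Y] (f : X ↪o Y)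
    {x y : DApp D X} (hlt : DLt D X x y) : DLt D Y (DMap D f x) (DMap D f y) := by
  have hu : (DMap D f x).a ∪ (DMap D f y).a = (x.a ∪ y.a).map f.toEmbedding :=
    (Finset.map_union x.a y.a).symm
  have hc : (x.a ∪ y.a).card = ((DMap D f x).a ∪ (DMap D f y).a).card := by
    rw [hu, Finset.card_map]
  have hx := map_inclEmb_castA D f (b := (DMap D f x).a) rfl hu Finset.subset_union_left
    Finset.subset_union_left (Finset.card_map f.toEmbedding).symm hc x.σ
  have hy := map_inclEmb_castA D f (b := (DMap D f y).a) rfl hu Finset.subset_union_right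
    Finset.subset_union_right (Finset.card_map f.toEmbedding).symm hc y.σ
  exact lt_of_eq_of_lt hx (lt_of_lt_of_eq (castA_lt_castA D hc hlt) hy.symm)

/-- For any coded prae-dilator `T`, the construction `D^T` is a prae-dilator on
all linear orders: for every order embedding `f : X ↪o Y` the map
`D^T_f(⟨a,σ⟩) := ⟨f[a],σ⟩` is strictly increasing from `D^T_X` to `D^T_Y`; `D^T` preserves
identities and composition; `supp^{D^T}_X(⟨a,σ⟩) := a` is a natural transformation; and every
`⟨a,σ⟩ ∈ D^T_X` lies in the range of `D^T` applied to the inclusion `a ↪ X`. -/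
theorem DMap_is_praedilator (D : PraeDilator) :
    (∀ (X Y : Type) [LinearOrder X] [LinearOrder Y] (f : X ↪o Y) (x y : DApp D X),
        DLt D X x y → DLt D Y (DMap D f x) (DMap D f y)) ∧
    (∀ (X : Type) [LinearOrder X] (x : DApp D X),
        DMap D (OrderIso.refl X).toOrderEmbedding x = x) ∧
    (∀ (X Y Z : Type) [LinearOrder X] [LinearOrder Y] [LinearOrder Z]
        (f : X ↪o Y) (g : Y ↪o Z) (x : DApp D X),
        DMap D (f.trans g) x = DMap D g (DMap D f x)) ∧
    (∀ (X Y : Type) [LinearOrder X] [LinearOrder Y] (f : X ↪o Y) (x : DApp D X),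
        (DMap D f x).a = x.a.map f.toEmbedding) ∧
    (∀ (X : Type) [LinearOrder X] (x : DApp D X),
        ∃ y : DApp D {z // z ∈ x.a}, DMap D (OrderEmbedding.subtype (· ∈ x.a)) y = x) := by
  refine ⟨fun X Y _ _ f x y hlt => hlt.map f, fun X _ x => ?_, fun X Y Z _ _ _ f g x => ?_,
    fun X Y _ _ f x => rfl, fun X _ x => ?_⟩
  · refine DApp.ext_castA (Finset.map_refl (s := x.a)) ?_
    exact castA_castA D _ _ x.σ
  · refine DApp.ext_castA (Finset.map_map f.toEmbedding g.toEmbedding x.a).symm ?_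
    exact (castA_castA D _ _ x.σ).trans (castA_castA D _ _ x.σ).symm
  · refine ⟨⟨x.a.attach, castA D Finset.card_attach.symm x.σ,
      (supp_castA D _ _).mpr x.hsupp⟩, ?_⟩
    refine DApp.ext_castA (Finset.attach_map_val (s := x.a)) ?_
    exact (castA_castA D _ _ _).trans
      (castA_castA D Finset.card_attach.symm _ x.σ)
end

section
/- A coded prae-dilator T has a well-founded Bachmann-Howard fixed point (i.e. there exists a well-order X together with a Bachmann-Howard collapse ϑ : D^T_X → X) if and only if the linear order ϑ(T) is well-founded. -/
/-- Terms of the notation system `ϑ(T)`: a term `ϑ_σ^{s₀,…,s_{n−1}}` consists of a finite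
sequence of previously constructed terms together with an element `σ ∈ T_n`. -/
inductive ThT (D : PraeDilator) : Type where
  | node (n : ℕ) (ss : Fin n → ThT D) (σ : D.A n) : ThT D

/-- Size of a term of `ϑ(T)`. -/
def tsizeT (D : PraeDilator) : ThT D → ℕ
  | .node _ ss _ => (Finset.univ.sum fun i => tsizeT D (ss i)) + 1

theorem tsizeT_lt (D : PraeDilator) (n : ℕ) (ss : Fin n → ThT D) (σ : D.A n) (i : Fin n) :
    tsizeT D (ss i) < tsizeT D (.node n ss σ) := by
  have : tsizeT D (ss i) ≤ Finset.univ.sum fun j => tsizeT D (ss j) :=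
    Finset.single_le_sum (f := fun j => tsizeT D (ss j)) (fun _ _ => Nat.zero_le _) (Finset.mem_univ i)
  calc tsizeT D (ss i) ≤ _ := this
    _ < _ + 1 := Nat.lt_succ_self _
    _ = tsizeT D (.node n ss σ) := by rw [tsizeT]

/-- The relation `<_{ϑ(T)}` on terms of `ϑ(T)`, following the simultaneous recursive
definition: `ϑ_σ^{s₀,…,s_{n−1}} < ϑ_τ^{t₀,…,t_{m−1}}` iff either (i') `T_f(σ) <_{T_k} T_g(τ)`
for the strictly increasing `f : n → k` and `g : m → k` onto `k = |{s₀,…,t_{m−1}}|` with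
`f i < g j ↔ s_i < t_j` and `g j < f i ↔ t_j < s_i`, together with `n = 0` or `s_{n−1} < t`;
or (ii') `m > 0` and `s ≤ t_{m−1}`. -/
def tlt (D : PraeDilator) : ThT D → ThT D → Prop
  | .node n ss σ, .node m ts τ =>
    ((∃ (k : ℕ) (f : Fin n ↪o Fin k) (g : Fin m ↪o Fin k),
      (∀ (i : Fin n) (j : Fin m), f i < g j ↔ tlt D (ss i) (ts j)) ∧
      (∀ (i : Fin n) (j : Fin m), g j < f i ↔ tlt D (ts j) (ss i)) ∧
      (∀ p : Fin k, (∃ i, f i = p) ∨ (∃ j, g j = p)) ∧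
      D.map f σ < D.map g τ) ∧
      (∀ h : 0 < n, tlt D (ss ⟨n - 1, Nat.sub_lt h Nat.one_pos⟩) (.node m ts τ))) ∨
    (∃ h : 0 < m,
      tlt D (.node n ss σ) (ts ⟨m - 1, Nat.sub_lt h Nat.one_pos⟩) ∨
      ThT.node n ss σ = ts ⟨m - 1, Nat.sub_lt h Nat.one_pos⟩)
termination_by s t => tsizeT D s + tsizeT D t
decreasing_by
  · have h1 := tsizeT_lt D n ss σ i
    have h2 := tsizeT_lt D m ts τ j
    omega
  · have h1 := tsizeT_lt D m ts τ j
    have h2 := tsizeT_lt D n ss σ i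
    omega
  · have h1 := tsizeT_lt D n ss σ ⟨n - 1, Nat.sub_lt h Nat.one_pos⟩
    omega
  · have h1 := tsizeT_lt D m ts τ ⟨m - 1, Nat.sub_lt h Nat.one_pos⟩
    omega

/-- Well-formed terms of `ϑ(T)`: in `ϑ_σ^{s₀,…,s_{n−1}}` the listed terms must be
well-formed and strictly increasing, and `σ ∈ T_n` must have full support
`supp^T_n(σ) = {0,…,n−1}`. -/
inductive ThTWF (D : PraeDilator) : ThT D → Prop where
  | node (n : ℕ) (ss : Fin n → ThT D) (σ : D.A n) :
      (∀ i, ThTWF D (ss i)) → (∀ i j : Fin n, i < j → tlt D (ss i) (ss j)) →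
      D.supp n σ = Finset.univ → ThTWF D (.node n ss σ)

/-- `θ : A → X` is a Bachmann-Howard collapse with respect to the relations `ltA`, `ltX` and
the support function `supp`. -/
def IsBHCollapse {A X : Type} (ltA : A → A → Prop) (ltX : X → X → Prop)
    (supp : A → Finset X) (θ : A → X) : Prop :=
  (∀ σ τ : A, ltA σ τ → (∀ x ∈ supp σ, ltX x (θ τ)) → ltX (θ σ) (θ τ)) ∧
  (∀ σ : A, ∀ x ∈ supp σ, ltX x (θ σ))

section TupleLt

variable {D : PraeDilator}

theorem PraeDilator.map_lt_map_iff (D : PraeDilator) {n m : ℕ} (f : Fin n ↪o Fin m)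
    {σ τ : D.A n} : D.map f σ < D.map f τ ↔ σ < τ :=
  (show StrictMono (D.map f) from fun _ _ h => D.map_strictMono f _ _ h).lt_iff_lt

theorem PraeDilator.map_injective (D : PraeDilator) {n m : ℕ} (f : Fin n ↪o Fin m) :
    Function.Injective (D.map f) :=
  (show StrictMono (D.map f) from fun _ _ h => D.map_strictMono f _ _ h).injective

/-- The comparison of `⟨s, σ⟩` and `⟨t, τ⟩` in the extension of `D` to the linear order `X`,
where the finite subsets of `X` are given by their increasing enumerations `s` and `t`. -/
def TupleLt (D : PraeDilator) {X : Type} [LinearOrder X] {n m : ℕ}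
    (s : Fin n ↪o X) (σ : D.A n) (t : Fin m ↪o X) (τ : D.A m) : Prop :=
  ∃ (k : ℕ) (e : Fin k ↪o X) (f : Fin n ↪o Fin k) (g : Fin m ↪o Fin k),
    f.trans e = s ∧ g.trans e = t ∧ D.map f σ < D.map g τ

variable {X : Type} [LinearOrder X] {n m k l : ℕ}

theorem exists_trans_eq (e : Fin k ↪o X) (s : Fin n ↪o X) (h : ∀ i, ∃ p, e p = s i) :
    ∃ f : Fin n ↪o Fin k, f.trans e = s := by
  choose f hf using h
  refine ⟨OrderEmbedding.ofStrictMono f fun i j hij => ?_, ?_⟩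
  · rw [← e.lt_iff_lt, hf, hf]
    exact s.strictMono hij
  · ext i
    exact hf i

theorem exists_common (s : Fin n ↪o X) (t : Fin m ↪o X) :
    ∃ (k : ℕ) (e : Fin k ↪o X) (f : Fin n ↪o Fin k) (g : Fin m ↪o Fin k),
      f.trans e = s ∧ g.trans e = t ∧ ∀ p, (∃ i, f i = p) ∨ (∃ j, g j = p) := by
  classical
  let d : Finset X := Finset.univ.map s.toEmbedding ∪ Finset.univ.map t.toEmbedding
  have hd : ∀ x, x ∈ d ↔ (∃ i, s i = x) ∨ (∃ j, t j = x) := fun x => by simp [d]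
  have hr : ∀ x, x ∈ d → ∃ p, d.orderEmbOfFin rfl p = x := fun x hx => by
    rw [← Finset.mem_coe, ← d.range_orderEmbOfFin rfl] at hx
    exact hx
  obtain ⟨f, hf⟩ := exists_trans_eq (d.orderEmbOfFin rfl) s fun i => hr _ <| (hd _).2 (.inl ⟨i, rfl⟩)
  obtain ⟨g, hg⟩ := exists_trans_eq (d.orderEmbOfFin rfl) t fun i => hr _ <| (hd _).2 (.inr ⟨i, rfl⟩)
  refine ⟨_, d.orderEmbOfFin rfl, f, g, hf, hg, fun p => ?_⟩
  refine ((hd _).1 (d.orderEmbOfFin_mem rfl p)).imp ?_ ?_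
  · rintro ⟨i, hi⟩
    exact ⟨i, (d.orderEmbOfFin rfl).injective (by rw [← hi, ← hf]; rfl)⟩
  · rintro ⟨i, hi⟩
    exact ⟨i, (d.orderEmbOfFin rfl).injective (by rw [← hi, ← hg]; rfl)⟩

theorem trans_right_cancel (e : Fin k ↪o X) {f g : Fin n ↪o Fin k}
    (h : f.trans e = g.trans e) : f = g := by
  ext1 i
  exact e.injective (DFunLike.congr_fun h i)

theorem tupleLt_iff (e : Fin k ↪o X) (f : Fin n ↪o Fin k) (g : Fin m ↪o Fin k)
    {σ : D.A n} {τ : D.A m} :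
    TupleLt D (f.trans e) σ (g.trans e) τ ↔ D.map f σ < D.map g τ := by
  refine ⟨?_, fun h => ⟨k, e, f, g, rfl, rfl, h⟩⟩
  rintro ⟨k', e', f', g', hf, hg, h⟩
  obtain ⟨k'', e'', u, u', rfl, rfl, -⟩ := exists_common e e'
  have hf' : f'.trans u' = f.trans u := trans_right_cancel e'' hf
  have hg' : g'.trans u' = g.trans u := trans_right_cancel e'' hg
  rwa [← D.map_lt_map_iff u', ← D.map_comp, ← D.map_comp, hf', hg', D.map_comp, D.map_comp,
    D.map_lt_map_iff] at h

theorem not_tupleLt_self (s : Fin n ↪o X) (σ : D.A n) : ¬ TupleLt D s σ s σ := by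
  obtain ⟨k, e, f, -, rfl, -, -⟩ := exists_common s s
  rw [tupleLt_iff]
  exact lt_irrefl _

theorem TupleLt.trans {s : Fin n ↪o X} {σ : D.A n} {t : Fin m ↪o X} {τ : D.A m}
    {r : Fin l ↪o X} {ρ : D.A l} (h₁ : TupleLt D s σ t τ) (h₂ : TupleLt D t τ r ρ) :
    TupleLt D s σ r ρ := by
  obtain ⟨k, e, f, g, rfl, rfl, -⟩ := exists_common s t
  obtain ⟨k', e', u, v, rfl, rfl, -⟩ := exists_common e r
  change TupleLt D ((f.trans u).trans e') σ ((g.trans u).trans e') τ at h₁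
  change TupleLt D ((g.trans u).trans e') τ _ ρ at h₂
  change TupleLt D ((f.trans u).trans e') σ _ ρ
  rw [tupleLt_iff] at *
  exact h₁.trans h₂

theorem tupleLt_trichotomy (s : Fin n ↪o X) {σ : D.A n} (t : Fin m ↪o X) {τ : D.A m}
    (hσ : D.supp n σ = Finset.univ) (hτ : D.supp m τ = Finset.univ) :
    TupleLt D s σ t τ ∨ TupleLt D t τ s σ ∨
      ∃ h : n = m, (∀ i, s i = t (Fin.cast h i)) ∧ h ▸ σ = τ := by
  obtain ⟨k, e, f, g, rfl, rfl, -⟩ := exists_common s t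
  rw [tupleLt_iff, tupleLt_iff]
  rcases lt_trichotomy (D.map f σ) (D.map g τ) with h | h | h
  · exact .inl h
  · refine .inr (.inr ?_)
    have hs := congrArg (D.supp k) h
    rw [D.supp_natural, D.supp_natural, hσ, hτ] at hs
    have hnm : n = m := by simpa using congrArg Finset.card hs
    subst hnm
    have hfg : f = g := by
      rw [← OrderEmbedding.range_inj]
      simpa using congrArg (fun a : Finset (Fin k) => (a : Set (Fin k))) hs
    subst hfg
    exact ⟨rfl, fun i => rfl, D.map_injective f h⟩
  · exact .inr (.inl h)

theorem tupleLt_trans_left {s : Fin m ↪o X} {f : Fin n ↪o Fin m} {σ : D.A n}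
    {t : Fin l ↪o X} {τ : D.A l} :
    TupleLt D (f.trans s) σ t τ ↔ TupleLt D s (D.map f σ) t τ := by
  obtain ⟨k, e, u, v, rfl, rfl, -⟩ := exists_common s t
  change TupleLt D ((f.trans u).trans e) σ _ τ ↔ _
  rw [tupleLt_iff, tupleLt_iff, D.map_comp]

theorem tupleLt_trans_right {s : Fin m ↪o X} {f : Fin n ↪o Fin m} {σ : D.A n}
    {t : Fin l ↪o X} {τ : D.A l} :
    TupleLt D t τ (f.trans s) σ ↔ TupleLt D t τ s (D.map f σ) := by
  obtain ⟨k, e, u, v, rfl, rfl, -⟩ := exists_common s t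
  change TupleLt D _ τ ((f.trans u).trans e) σ ↔ _
  rw [tupleLt_iff, tupleLt_iff, D.map_comp]

theorem TupleLt.exists_cover {s : Fin n ↪o X} {σ : D.A n} {t : Fin m ↪o X} {τ : D.A m}
    (h : TupleLt D s σ t τ) :
    ∃ (k : ℕ) (e : Fin k ↪o X) (f : Fin n ↪o Fin k) (g : Fin m ↪o Fin k),
      f.trans e = s ∧ g.trans e = t ∧ (∀ p, (∃ i, f i = p) ∨ (∃ j, g j = p)) ∧
      D.map f σ < D.map g τ := by
  obtain ⟨k, e, f, g, rfl, rfl, hc⟩ := exists_common s t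
  exact ⟨k, e, f, g, rfl, rfl, hc, (tupleLt_iff e f g).1 h⟩

theorem inclEmb_trans {a d : Finset X} (h : a ⊆ d) :
    (inclEmb h).trans (d.orderEmbOfFin rfl) = a.orderEmbOfFin rfl := by
  ext i
  change ((d.orderIsoOfFin rfl ((d.orderIsoOfFin rfl).symm _) : d) : X) = _
  rw [OrderIso.apply_symm_apply]

theorem dLt_iff_tupleLt (x y : DApp D X) :
    DLt D X x y ↔ TupleLt D (x.a.orderEmbOfFin rfl) x.σ (y.a.orderEmbOfFin rfl) y.σ := by
  rw [DLt, ← tupleLt_iff ((x.a ∪ y.a).orderEmbOfFin rfl), inclEmb_trans, inclEmb_trans]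

/-- The element of `D^T_X` given by the increasing enumeration of a finite subset of `X`. -/
def DApp.ofTuple (s : Fin n ↪o X) (σ : D.A n) (hσ : D.supp n σ = Finset.univ) : DApp D X where
  a := Finset.univ.map s.toEmbedding
  σ := D.map (Fin.castOrderIso (by simp)).toOrderEmbedding σ
  hsupp := by
    rw [D.supp_natural, hσ]
    ext i
    simp only [Finset.mem_map, Finset.mem_univ, true_and, iff_true]
    exact (Fin.castOrderIso _).surjective i

theorem DApp.mem_ofTuple {s : Fin n ↪o X} {σ : D.A n} {hσ : D.supp n σ = Finset.univ} {x : X} :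
    x ∈ (DApp.ofTuple s σ hσ).a ↔ ∃ i, s i = x := by
  simp [DApp.ofTuple]

theorem DApp.cast_trans_ofTuple (s : Fin n ↪o X) (σ : D.A n) (hσ : D.supp n σ = Finset.univ)
    (h : n = (DApp.ofTuple s σ hσ).a.card) :
    (Fin.castOrderIso h).toOrderEmbedding.trans
      ((DApp.ofTuple s σ hσ).a.orderEmbOfFin rfl) = s := by
  have h₁ := Finset.orderEmbOfFin_unique' h.symm (f := s) fun i => DApp.mem_ofTuple.2 ⟨i, rfl⟩
  have h₂ := Finset.orderEmbOfFin_unique' h.symm (f := (Fin.castOrderIso h).toOrderEmbedding.trans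
      ((DApp.ofTuple s σ hσ).a.orderEmbOfFin rfl)) fun i => Finset.orderEmbOfFin_mem _ rfl _
  exact h₂.trans h₁.symm

theorem dLt_ofTuple_iff {s : Fin n ↪o X} {σ : D.A n} {hσ : D.supp n σ = Finset.univ}
    {t : Fin m ↪o X} {τ : D.A m} {hτ : D.supp m τ = Finset.univ} :
    DLt D X (DApp.ofTuple s σ hσ) (DApp.ofTuple t τ hτ) ↔ TupleLt D s σ t τ := by
  have hs : n = (DApp.ofTuple s σ hσ).a.card := by simp [DApp.ofTuple]
  have ht : m = (DApp.ofTuple t τ hτ).a.card := by simp [DApp.ofTuple]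
  rw [dLt_iff_tupleLt]
  conv_rhs => rw [← DApp.cast_trans_ofTuple s σ hσ hs, ← DApp.cast_trans_ofTuple t τ hτ ht,
    tupleLt_trans_left, tupleLt_trans_right]
  rfl

end TupleLt

section TermOrder

variable {D : PraeDilator} {X : Type} [LinearOrder X]

theorem tlt_node_iff (φ : X → ThT D) (hφ : ∀ x y, tlt D (φ x) (φ y) ↔ x < y) {n m : ℕ}
    (s : Fin n ↪o X) (σ : D.A n) (t : Fin m ↪o X) (τ : D.A m) :
    tlt D (.node n (φ ∘ s) σ) (.node m (φ ∘ t) τ) ↔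
      (TupleLt D s σ t τ ∧ ∀ h : 0 < n,
        tlt D (φ (s ⟨n - 1, Nat.sub_lt h Nat.one_pos⟩)) (.node m (φ ∘ t) τ)) ∨
      ∃ h : 0 < m,
        tlt D (.node n (φ ∘ s) σ) (φ (t ⟨m - 1, Nat.sub_lt h Nat.one_pos⟩)) ∨
        ThT.node n (φ ∘ s) σ = φ (t ⟨m - 1, Nat.sub_lt h Nat.one_pos⟩) := by
  rw [tlt]
  refine or_congr (and_congr ?_ Iff.rfl) Iff.rfl
  simp only [Function.comp_apply, hφ]
  constructor
  · rintro ⟨k, f, g, h₁, h₂, hc, h⟩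
    have h₃ : ∀ i j, f i = g j ↔ s i = t j := fun i j => by
      rw [eq_iff_le_not_lt, eq_iff_le_not_lt, ← not_lt, ← not_lt, h₁, h₂]
    have he : ∀ p, ∃ x, (∀ i, f i = p → s i = x) ∧ (∀ j, g j = p → t j = x) := by
      intro p
      rcases hc p with ⟨i, rfl⟩ | ⟨j, rfl⟩
      · exact ⟨s i, fun i' h => by rw [f.injective h], fun j h => ((h₃ _ _).1 h.symm).symm⟩
      · exact ⟨t j, fun i h => (h₃ _ _).1 h, fun j' h => by rw [g.injective h]⟩
    choose e hef heg using he
    have hef' : ∀ i, e (f i) = s i := fun i => (hef _ i rfl).symm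
    have heg' : ∀ j, e (g j) = t j := fun j => (heg _ j rfl).symm
    have hmono : StrictMono e := by
      intro p q hpq
      rcases hc p with ⟨i, rfl⟩ | ⟨i, rfl⟩ <;> rcases hc q with ⟨j, rfl⟩ | ⟨j, rfl⟩ <;>
        simp only [hef', heg']
      · exact s.strictMono (f.lt_iff_lt.1 hpq)
      · exact (h₁ _ _).1 hpq
      · exact (h₂ _ _).1 hpq
      · exact t.strictMono (g.lt_iff_lt.1 hpq)
    exact ⟨k, OrderEmbedding.ofStrictMono e hmono, f, g, RelEmbedding.ext hef',
      RelEmbedding.ext heg', h⟩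
  · intro h
    obtain ⟨k, e, f, g, rfl, rfl, hc, h⟩ := h.exists_cover
    exact ⟨k, f, g, fun i j => e.lt_iff_lt.symm, fun i j => e.lt_iff_lt.symm, hc, h⟩

theorem tlt_node_of_le_last {s : ThT D} {m : ℕ} {ts : Fin m → ThT D} {τ : D.A m} (hm : 0 < m)
    (h : tlt D s (ts ⟨m - 1, Nat.sub_lt hm Nat.one_pos⟩) ∨
      s = ts ⟨m - 1, Nat.sub_lt hm Nat.one_pos⟩) : tlt D s (.node m ts τ) := by
  cases s
  rw [tlt]
  exact .inr ⟨hm, h⟩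

theorem exists_eq_node (φ : X → ThT D) (hφ : ∀ x y, tlt D (φ x) (φ y) ↔ x < y) {s : ThT D}
    (hs : ThTWF D s) (hsurj : ∀ t, ThTWF D t → tsizeT D t < tsizeT D s → ∃ x, φ x = t) :
    ∃ (n : ℕ) (ss : Fin n ↪o X) (σ : D.A n),
      D.supp n σ = Finset.univ ∧ s = .node n (φ ∘ ss) σ := by
  obtain ⟨n, ss, σ, hwf, hlt, hσ⟩ := hs
  choose x hx using fun i => hsurj (ss i) (hwf i) (tsizeT_lt D n ss σ i)
  refine ⟨n, OrderEmbedding.ofStrictMono x fun i j hij => ?_, σ, hσ, ?_⟩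
  · rw [← hφ, hx, hx]
    exact hlt i j hij
  · congr 1
    funext i
    exact (hx i).symm

variable {φ : X → ThT D} {N : ℕ}

theorem tlt_trans_of_embedding (hφ : ∀ x y, tlt D (φ x) (φ y) ↔ x < y)
    (hsurj : ∀ t, ThTWF D t → tsizeT D t < N → ∃ x, φ x = t) (hwf : ∀ x, ThTWF D (φ x))
    {s t r : ThT D} (hs : ThTWF D s) (ht : ThTWF D t) (hr : ThTWF D r)
    (hsN : tsizeT D s ≤ N) (htN : tsizeT D t ≤ N) (hrN : tsizeT D r ≤ N)
    (hst : tlt D s t) (htr : tlt D t r) : tlt D s r := by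
  induction hB : tsizeT D s + tsizeT D t + tsizeT D r using Nat.strong_induction_on
    generalizing s t r with
  | _ B ih =>
    obtain ⟨n, ss, σ, hσ, rfl⟩ := exists_eq_node φ hφ hs fun t h h' => hsurj t h (by omega)
    obtain ⟨m, ts, τ, hτ, rfl⟩ := exists_eq_node φ hφ ht fun t h h' => hsurj t h (by omega)
    obtain ⟨l, rs, ρ, hρ, rfl⟩ := exists_eq_node φ hφ hr fun t h h' => hsurj t h (by omega)
    have hst' := (tlt_node_iff φ hφ _ _ _ _).1 hst
    have htr' := (tlt_node_iff φ hφ _ _ _ _).1 htr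
    have hs' := tsizeT_lt D n (φ ∘ ss) σ
    have ht' := tsizeT_lt D m (φ ∘ ts) τ
    have hr' := tsizeT_lt D l (φ ∘ rs) ρ
    simp only [Function.comp_apply] at hs' ht' hr'
    rcases htr' with ⟨htr₁, htr₂⟩ | ⟨hl, htr'⟩
    · rcases hst' with ⟨hst₁, hst₂⟩ | ⟨hm, hst'⟩
      · refine (tlt_node_iff φ hφ _ _ _ _).2 (.inl ⟨hst₁.trans htr₁, fun hn => ?_⟩)
        have := hs' ⟨n - 1, Nat.sub_lt hn Nat.one_pos⟩
        exact ih _ (by omega) (hwf _) ht hr (by omega) htN hrN (hst₂ hn) htr rfl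
      · have := ht' ⟨m - 1, Nat.sub_lt hm Nat.one_pos⟩
        rcases hst' with hst' | hst'
        · exact ih _ (by omega) hs (hwf _) hr hsN (by omega) hrN hst' (htr₂ hm) rfl
        · rw [hst']
          exact htr₂ hm
    · refine (tlt_node_iff φ hφ _ _ _ _).2 (.inr ⟨hl, .inl ?_⟩)
      have := hr' ⟨l - 1, Nat.sub_lt hl Nat.one_pos⟩
      rcases htr' with htr' | htr'
      · exact ih _ (by omega) hs ht (hwf _) hsN htN (by omega) hst htr' rfl
      · rwa [htr'] at hst

theorem tlt_irrefl_of_embedding (hφ : ∀ x y, tlt D (φ x) (φ y) ↔ x < y)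
    (hsurj : ∀ t, ThTWF D t → tsizeT D t < N → ∃ x, φ x = t) (hwf : ∀ x, ThTWF D (φ x))
    {s : ThT D} (hs : ThTWF D s) (hsN : tsizeT D s ≤ N) : ¬ tlt D s s := by
  intro h
  obtain ⟨n, ss, σ, hσ, rfl⟩ := exists_eq_node φ hφ hs fun t h h' => hsurj t h (by omega)
  have hs' := tsizeT_lt D n (φ ∘ ss) σ
  simp only [Function.comp_apply] at hs'
  rcases (tlt_node_iff φ hφ _ _ _ _).1 h with ⟨h, -⟩ | ⟨hn, h⟩
  · exact not_tupleLt_self _ _ h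
  · have hlt := hs' ⟨n - 1, Nat.sub_lt hn Nat.one_pos⟩
    rcases h with h | h
    · refine lt_irrefl _ ((hφ _ _).1 (tlt_trans_of_embedding hφ hsurj hwf (hwf _) hs (hwf _)
        (by omega) hsN (by omega) (tlt_node_of_le_last hn (.inr rfl)) h))
    · rw [← h] at hlt
      exact lt_irrefl _ hlt

theorem tlt_trichotomy_of_embedding (hφ : ∀ x y, tlt D (φ x) (φ y) ↔ x < y)
    (hsurj : ∀ t, ThTWF D t → tsizeT D t < N → ∃ x, φ x = t) (hwf : ∀ x, ThTWF D (φ x))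
    {s t : ThT D} (hs : ThTWF D s) (ht : ThTWF D t)
    (hsN : tsizeT D s ≤ N) (htN : tsizeT D t ≤ N) :
    tlt D s t ∨ tlt D t s ∨ s = t := by
  induction hB : tsizeT D s + tsizeT D t using Nat.strong_induction_on generalizing s t with
  | _ B ih =>
    obtain ⟨n, ss, σ, hσ, rfl⟩ := exists_eq_node φ hφ hs fun t h h' => hsurj t h (by omega)
    obtain ⟨m, ts, τ, hτ, rfl⟩ := exists_eq_node φ hφ ht fun t h h' => hsurj t h (by omega)
    have hs' := tsizeT_lt D n (φ ∘ ss) σ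
    have ht' := tsizeT_lt D m (φ ∘ ts) τ
    simp only [Function.comp_apply] at hs' ht'
    rcases tupleLt_trichotomy ss ts hσ hτ with h | h | ⟨rfl, hst, rfl⟩
    · by_cases hn : 0 < n
      · have := hs' ⟨n - 1, Nat.sub_lt hn Nat.one_pos⟩
        rcases ih _ (by omega) (hwf (ss ⟨n - 1, _⟩)) ht (by omega) htN rfl with h' | h' | h'
        · exact .inl ((tlt_node_iff φ hφ _ _ _ _).2 (.inl ⟨h, fun _ => h'⟩))
        · exact .inr (.inl (tlt_node_of_le_last hn (.inl h')))
        · exact .inr (.inl (tlt_node_of_le_last hn (.inr h'.symm)))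
      · exact .inl ((tlt_node_iff φ hφ _ _ _ _).2 (.inl ⟨h, fun hn' => absurd hn' hn⟩))
    · by_cases hm : 0 < m
      · have := ht' ⟨m - 1, Nat.sub_lt hm Nat.one_pos⟩
        rcases ih _ (by omega) hs (hwf (ts ⟨m - 1, _⟩)) hsN (by omega) rfl with h' | h' | h'
        · exact .inl (tlt_node_of_le_last hm (.inl h'))
        · exact .inr (.inl ((tlt_node_iff φ hφ _ _ _ _).2 (.inl ⟨h, fun _ => h'⟩)))
        · exact .inl (tlt_node_of_le_last hm (.inr h'))
      · exact .inr (.inl ((tlt_node_iff φ hφ _ _ _ _).2 (.inl ⟨h, fun hm' => absurd hm' hm⟩)))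
    · refine .inr (.inr ?_)
      congr 1
      exact funext fun i => congrArg φ (hst i)

open Classical in
/-- The linear order on a type of terms on which `tlt` is a strict linear order. -/
noncomputable abbrev linearOrderOfTlt (Q : ThT D → Prop)
    (htrans : ∀ s t r, Q s → Q t → Q r → tlt D s t → tlt D t r → tlt D s r)
    (hirrefl : ∀ s, Q s → ¬ tlt D s s)
    (htri : ∀ s t, Q s → Q t → tlt D s t ∨ tlt D t s ∨ s = t) : LinearOrder {t // Q t} :=
  letI : IsStrictTotalOrder {t // Q t} fun s t => tlt D s.1 t.1 :=
    { trichotomous := fun s t h₁ h₂ =>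
        Subtype.ext (((htri s.1 t.1 s.2 t.2).resolve_left h₁).resolve_left h₂)
      irrefl := fun s => hirrefl s.1 s.2
      trans := fun s t r => htrans s.1 t.1 r.1 s.2 t.2 r.2 }
  linearOrderOfSTO fun s t : {t // Q t} => tlt D s.1 t.1

theorem exists_linearOrder_below (D : PraeDilator) (N : ℕ) :
    ∃ L : LinearOrder {t : ThT D // ThTWF D t ∧ tsizeT D t < N},
      ∀ s t, tlt D s.1 t.1 ↔ L.lt s t := by
  induction N with
  | zero =>
    exact ⟨linearOrderOfTlt _ (fun s _ _ h => absurd h.2 (by omega))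
      (fun s h => absurd h.2 (by omega)) (fun s _ h => absurd h.2 (by omega)), fun s t => Iff.rfl⟩
  | succ N ih =>
    obtain ⟨L, hL⟩ := ih
    have hsurj : ∀ t, ThTWF D t → tsizeT D t < N →
        ∃ x : {t : ThT D // ThTWF D t ∧ tsizeT D t < N}, x.1 = t := fun t h h' => ⟨⟨t, h, h'⟩, rfl⟩
    have hwf : ∀ x : {t : ThT D // ThTWF D t ∧ tsizeT D t < N}, ThTWF D x.1 := fun x => x.2.1
    refine ⟨linearOrderOfTlt _ (fun s t r hs ht hr => ?_) (fun s hs => ?_)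
      (fun s t hs ht => ?_), fun s t => Iff.rfl⟩
    · exact tlt_trans_of_embedding hL hsurj hwf hs.1 ht.1 hr.1 (Nat.le_of_lt_succ hs.2)
        (Nat.le_of_lt_succ ht.2) (Nat.le_of_lt_succ hr.2)
    · exact tlt_irrefl_of_embedding hL hsurj hwf hs.1 (Nat.le_of_lt_succ hs.2)
    · exact tlt_trichotomy_of_embedding hL hsurj hwf hs.1 ht.1 (Nat.le_of_lt_succ hs.2)
        (Nat.le_of_lt_succ ht.2)

theorem tlt_trans {s t r : ThT D} (hs : ThTWF D s) (ht : ThTWF D t) (hr : ThTWF D r)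
    (hst : tlt D s t) (htr : tlt D t r) : tlt D s r := by
  obtain ⟨L, hL⟩ := exists_linearOrder_below D (tsizeT D s + tsizeT D t + tsizeT D r + 1)
  have hst' := (hL ⟨s, hs, by omega⟩ ⟨t, ht, by omega⟩).1 hst
  have htr' := (hL ⟨t, ht, by omega⟩ ⟨r, hr, by omega⟩).1 htr
  exact (hL ⟨s, hs, by omega⟩ ⟨r, hr, by omega⟩).2 (lt_trans hst' htr')

theorem tlt_irrefl {s : ThT D} (hs : ThTWF D s) : ¬ tlt D s s := by
  obtain ⟨L, hL⟩ := exists_linearOrder_below D (tsizeT D s + 1)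
  exact fun h => lt_irrefl _ ((hL ⟨s, hs, by omega⟩ ⟨s, hs, by omega⟩).1 h)

theorem tlt_trichotomy {s t : ThT D} (hs : ThTWF D s) (ht : ThTWF D t) :
    tlt D s t ∨ tlt D t s ∨ s = t := by
  obtain ⟨L, hL⟩ := exists_linearOrder_below D (tsizeT D s + tsizeT D t + 1)
  rcases lt_trichotomy (α := {r : ThT D // ThTWF D r ∧ tsizeT D r < tsizeT D s + tsizeT D t + 1})
    ⟨s, hs, by omega⟩ ⟨t, ht, by omega⟩ with h | h | h
  · exact .inl ((hL _ _).2 h)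
  · exact .inr (.inr (congrArg Subtype.val h))
  · exact .inr (.inl ((hL _ _).2 h))

noncomputable instance : LinearOrder {t : ThT D // ThTWF D t} :=
  linearOrderOfTlt _ (fun _ _ _ => tlt_trans) (fun _ => tlt_irrefl) (fun _ _ => tlt_trichotomy)

theorem tlt_val_iff (s t : {t : ThT D // ThTWF D t}) : tlt D s.1 t.1 ↔ s < t := Iff.rfl

/-- The term `ϑ_σ^{s₀,…,s_{n−1}}` for well-formed terms `s₀ < … < s_{n−1}`. -/
noncomputable def wfNode {n : ℕ} (s : Fin n ↪o {t : ThT D // ThTWF D t}) (σ : D.A n)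
    (hσ : D.supp n σ = Finset.univ) : {t : ThT D // ThTWF D t} :=
  ⟨.node n (Subtype.val ∘ s) σ, .node n _ σ (fun i => (s i).2) (fun _ _ h => s.strictMono h) hσ⟩

theorem exists_eq_wfNode (s : {t : ThT D // ThTWF D t}) :
    ∃ (n : ℕ) (ss : Fin n ↪o {t : ThT D // ThTWF D t}) (σ : D.A n)
      (hσ : D.supp n σ = Finset.univ), s = wfNode ss σ hσ := by
  obtain ⟨n, ss, σ, hσ, h⟩ := exists_eq_node Subtype.val tlt_val_iff s.2
    fun t h _ => ⟨⟨t, h⟩, rfl⟩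
  exact ⟨n, ss, σ, hσ, Subtype.ext h⟩

variable {n m : ℕ} {s : Fin n ↪o {t : ThT D // ThTWF D t}} {σ : D.A n}
  {hσ : D.supp n σ = Finset.univ} {t : Fin m ↪o {t : ThT D // ThTWF D t}} {τ : D.A m}
  {hτ : D.supp m τ = Finset.univ}

theorem le_last (s : Fin n ↪o X) (i : Fin n) (hn : 0 < n) :
    s i ≤ s ⟨n - 1, Nat.sub_lt hn Nat.one_pos⟩ :=
  s.monotone (Fin.mk_le_mk.2 (Nat.le_sub_one_of_lt i.2))

theorem lt_wfNode_of_le {x : {t : ThT D // ThTWF D t}} {j : Fin m} (h : x ≤ t j) :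
    x < wfNode t τ hτ := by
  have hm := j.pos
  exact tlt_node_of_le_last hm ((h.trans (le_last t j hm)).lt_or_eq.imp id (congrArg Subtype.val))

theorem wfNode_lt_wfNode_iff : wfNode s σ hσ < wfNode t τ hτ ↔
    (TupleLt D s σ t τ ∧ ∀ i, s i < wfNode t τ hτ) ∨ ∃ j, wfNode s σ hσ ≤ t j := by
  refine (tlt_node_iff Subtype.val tlt_val_iff s σ t τ).trans
    (or_congr (and_congr_right fun _ => ⟨fun h i => ?_, fun h hn => h _⟩)
      ⟨fun ⟨hm, h⟩ => ⟨⟨m - 1, Nat.sub_lt hm Nat.one_pos⟩, ?_⟩, fun ⟨j, h⟩ => ⟨j.pos, ?_⟩⟩)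
  · exact lt_of_le_of_lt (le_last s i i.pos) (h i.pos)
  · exact le_iff_lt_or_eq.2 (h.imp id Subtype.ext)
  · exact (h.trans (le_last t j j.pos)).lt_or_eq.imp id (congrArg Subtype.val)

end TermOrder

section Collapse

variable {D : PraeDilator}

theorem isBHCollapse_wfNode (D : PraeDilator) :
    IsBHCollapse (DLt D {t : ThT D // ThTWF D t}) (· < ·) (fun x => x.a)
      (fun x => wfNode (x.a.orderEmbOfFin rfl) x.σ x.hsupp) := by
  refine ⟨fun x y hxy hx => ?_, fun x s hs => ?_⟩
  · exact wfNode_lt_wfNode_iff.2 (.inl ⟨(dLt_iff_tupleLt x y).1 hxy,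
      fun i => hx _ (Finset.orderEmbOfFin_mem _ _ _)⟩)
  · rw [← Finset.mem_coe, ← x.a.range_orderEmbOfFin rfl] at hs
    obtain ⟨i, rfl⟩ := hs
    exact lt_wfNode_of_le le_rfl

variable {X : Type} [LinearOrder X]

open Classical in
/-- The interpretation of terms of `ϑ(T)` in a Bachmann-Howard fixed point. -/
noncomputable def interp [Inhabited X] (θ : DApp D X → X) : ThT D → X
  | .node n ss σ =>
    if h : StrictMono (fun i => interp θ (ss i)) ∧ D.supp n σ = Finset.univ then
      θ (.ofTuple (OrderEmbedding.ofStrictMono _ h.1) σ h.2)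
    else default

theorem interp_lt_interp [Inhabited X] {θ : DApp D X → X}
    (hθ : IsBHCollapse (DLt D X) (· < ·) (fun x => x.a) θ) {s t : {t : ThT D // ThTWF D t}}
    (hst : s < t) : interp θ s.1 < interp θ t.1 := by
  have key : ∀ N, ∀ s t : {t : ThT D // ThTWF D t}, tsizeT D s.1 < N → tsizeT D t.1 < N →
      s < t → interp θ s.1 < interp θ t.1 := by
    intro N
    induction N with
    | zero => exact fun s t h => absurd h (by omega)
    | succ N ihN =>
      have hnode : ∀ (n : ℕ) (ss : Fin n ↪o {t : ThT D // ThTWF D t}) (σ : D.A n)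
          (hσ : D.supp n σ = Finset.univ), tsizeT D (wfNode ss σ hσ).1 < N + 1 →
          ∃ h : StrictMono fun i => interp θ (ss i).1, interp θ (wfNode ss σ hσ).1 =
            θ (.ofTuple (OrderEmbedding.ofStrictMono _ h) σ hσ) := by
        intro n ss σ hσ hN
        have h : StrictMono fun i => interp θ (ss i).1 := fun i j hij =>
          ihN _ _ ((tsizeT_lt D n _ σ i).trans_le (Nat.le_of_lt_succ hN))
            ((tsizeT_lt D n _ σ j).trans_le (Nat.le_of_lt_succ hN)) (ss.strictMono hij)
        refine ⟨h, ?_⟩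
        rw [wfNode, interp]
        exact dif_pos ⟨h, hσ⟩
      intro s t hs ht hst
      induction hB : tsizeT D s.1 + tsizeT D t.1 using Nat.strong_induction_on
        generalizing s t with
      | _ B ih =>
        obtain ⟨n, ss, σ, hσ, rfl⟩ := exists_eq_wfNode s
        obtain ⟨m, ts, τ, hτ, rfl⟩ := exists_eq_wfNode t
        obtain ⟨hms, hs'⟩ := hnode n ss σ hσ hs
        obtain ⟨hmt, ht'⟩ := hnode m ts τ hτ ht
        have hss : ∀ i, tsizeT D (ss i).1 < tsizeT D (wfNode ss σ hσ).1 := tsizeT_lt D n _ σ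
        have hts : ∀ i, tsizeT D (ts i).1 < tsizeT D (wfNode ts τ hτ).1 := tsizeT_lt D m _ τ
        rcases wfNode_lt_wfNode_iff.1 hst with ⟨h, h'⟩ | ⟨j, h⟩
        · rw [hs', ht']
          refine hθ.1 _ _ (dLt_ofTuple_iff.2 ?_) fun x hx => ?_
          · obtain ⟨k, e, f, g, rfl, rfl, hc, hk⟩ := h.exists_cover
            have he : StrictMono fun p => interp θ (e p).1 := by
              have hsize : ∀ p, tsizeT D (e p).1 < N := by
                intro p
                rcases hc p with ⟨i, rfl⟩ | ⟨i, rfl⟩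
                · exact (hss i).trans_le (Nat.le_of_lt_succ hs)
                · exact (hts i).trans_le (Nat.le_of_lt_succ ht)
              exact fun p q hpq => ihN _ _ (hsize p) (hsize q) (e.strictMono hpq)
            exact ⟨k, OrderEmbedding.ofStrictMono _ he, f, g, rfl, rfl, hk⟩
          · obtain ⟨i, rfl⟩ := DApp.mem_ofTuple.1 hx
            rw [← ht']
            have := hss i
            exact ih _ (by omega) _ _ (by omega) ht (h' i) rfl
        · have h₁ : interp θ (ts j).1 < interp θ (wfNode ts τ hτ).1 := by
            rw [ht']
            exact hθ.2 _ _ (DApp.mem_ofTuple.2 ⟨j, rfl⟩)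
          have := hts j
          rcases h.lt_or_eq with h | h
          · exact (ih _ (by omega) _ _ hs (by omega) h rfl).trans h₁
          · rwa [h]
  exact key (tsizeT D s.1 + tsizeT D t.1 + 1) s t (by omega) (by omega) hst

theorem nonempty_of_thTWF (θ : DApp D X → X) {t : ThT D} (ht : ThTWF D t) : Nonempty X := by
  induction ht with
  | node n ss σ _ _ hσ ih =>
    rcases n.eq_zero_or_pos with rfl | hn
    · exact ⟨θ (.ofTuple (OrderEmbedding.ofIsEmpty) σ hσ)⟩
    · exact ih ⟨0, hn⟩

end Collapse

/-- A coded prae-dilator `T` has a well-founded Bachmann-Howard fixed point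
(a well-order `X` together with a Bachmann-Howard collapse `ϑ : D^T_X → X`) if and only if
the linear order `ϑ(T)` is well-founded. -/
theorem bhFixedPoint_iff_thT_wellFounded (D : PraeDilator) :
    (∃ (X : Type) (L : LinearOrder X), WellFounded L.lt ∧
      ∃ θ : @DApp D X L → X,
        @IsBHCollapse (@DApp D X L) X (@DLt D X L) L.lt (fun x => x.a) θ) ↔
    WellFounded (fun s t : {t : ThT D // ThTWF D t} => tlt D s.val t.val) := by
  constructor
  · rintro ⟨X, L, hL, θ, hθ⟩
    rcases isEmpty_or_nonempty X with hX | ⟨⟨x⟩⟩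
    · exact ⟨fun s => hX.elim (nonempty_of_thTWF θ s.2).some⟩
    · let _ : Inhabited X := ⟨x⟩
      exact Subrelation.wf (fun h => interp_lt_interp hθ h)
        (InvImage.wf (fun s : {t : ThT D // ThTWF D t} => interp θ s.1) hL)
  · exact fun h => ⟨{t : ThT D // ThTWF D t}, inferInstance, h, _, isBHCollapse_wfNode D⟩
end
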